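/- Let χ̂_s(z) = T (∫_{σ(H)} 2(E₀−λ)/((E₀−λ)²−z²) dP^H_λ) T* with H a self-adjoint operator on ⋀^N L²(ℝ³) satisfying the standing assumptions and T ∈ B(⋀^N L²(ℝ³), 𝓗) for a Hilbert space 𝓗, and let Ω = inf σ_ess(H) − E₀. Then the poles of (1−χ̂_s)^{−1} are forward shifted with respect to the poles of χ̂_s: for every 0 < ω < Ω, Σ_{ω̃ ∈ P((1−χ̂_s)^{−1}), |ω̃|<ω} rank_{ω̃}((1−χ̂_s)^{−1}) ≤ Σ_{ω̃ ∈ P(χ̂_s), |ω̃|<ω} rank_{ω̃}(χ̂_s). -/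

import Mathlib

open MeasureTheory ENNReal NNReal Complex Asymptotics
open scoped InnerProductSpace Topology
noncomputable section

/-! ### Meromorphic families of operators (Definition 2.7) -/

section Merom

variable {E F : Type*} [NormedAddCommGroup E] [NormedSpace ℂ E]
  [NormedAddCommGroup F] [NormedSpace ℂ F]

/-- A finite-rank (bounded) operator. -/
def FiniteRankOp (A : E →L[ℂ] F) : Prop := FiniteDimensional ℂ ↥(LinearMap.range A.toLinearMap)

/-- `K` is a meromorphic family of operators near `z₀`: near `z₀` it equals a holomorphic
family plus finitely many finite-rank principal parts `K₋ⱼ/(z−z₀)ʲ`. -/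
def MeromAt (K : ℂ → (E →L[ℂ] F)) (z₀ : ℂ) : Prop :=
  ∃ (k : ℕ) (c : ℕ → (E →L[ℂ] F)) (K₀ : ℂ → (E →L[ℂ] F)) (U : Set ℂ),
    IsOpen U ∧ z₀ ∈ U ∧ AnalyticOnNhd ℂ K₀ U ∧ (∀ j, FiniteRankOp (c j)) ∧
    ∀ z ∈ U, z ≠ z₀ → K z = K₀ z + ∑ j ∈ Finset.range k, ((z - z₀) ^ (j + 1))⁻¹ • c j

/-- `K` is a meromorphic family of operators on the open set `D`. -/
def MeromOn (K : ℂ → (E →L[ℂ] F)) (D : Set ℂ) : Prop := ∀ z₀ ∈ D, MeromAt K z₀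

/-- `K` has a simple pole at `z₀` with (finite-rank, nonzero) residue `R`. -/
def SimplePoleAt (K : ℂ → (E →L[ℂ] F)) (z₀ : ℂ) (R : E →L[ℂ] F) : Prop :=
  R ≠ 0 ∧ FiniteRankOp R ∧
  ∃ (K₀ : ℂ → (E →L[ℂ] F)) (U : Set ℂ), IsOpen U ∧ z₀ ∈ U ∧ AnalyticOnNhd ℂ K₀ U ∧
    ∀ z ∈ U, z ≠ z₀ → K z = K₀ z + (z - z₀)⁻¹ • R

/-- `K` has a (simple) pole at `z₀`. -/
def IsPoleAt (K : ℂ → (E →L[ℂ] F)) (z₀ : ℂ) : Prop := ∃ R, SimplePoleAt K z₀ R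

open scoped Classical in
/-- The rank of a (simple) pole of `K` at `z₀`: the rank of the residue there
(`0` if there is no simple pole at `z₀`). -/
noncomputable def poleRank (K : ℂ → (E →L[ℂ] F)) (z₀ : ℂ) : ℕ :=
  if h : ∃ R, SimplePoleAt K z₀ R then Module.finrank ℂ ↥(LinearMap.range h.choose.toLinearMap) else 0

end Merom

/-- The domain `D_Ω = ℂ \ ((−∞,−Ω] ∪ [Ω,∞))`. -/
def DOmega (Ω : ℝ) : Set ℂ := {z : ℂ | z.im ≠ 0 ∨ |z.re| < Ω}
/-! ### Self-adjoint Hamiltonians, encoded through their projection-valued spectral measure -/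

open scoped InnerProductSpace

/-- The spectral data of a self-adjoint Hamiltonian `H`: the projection-valued spectral
measure `A ↦ P^H(A)` together with the diagonal spectral measures
`x ↦ μ_x = ⟪x, P^H(·) x⟫ = ‖P^H(·)x‖²`. -/
structure SpectralData (𝓗 : Type*) [NormedAddCommGroup 𝓗] [InnerProductSpace ℂ 𝓗] where
  proj : Set ℝ → (𝓗 →L[ℂ] 𝓗)
  diag : 𝓗 → MeasureTheory.Measure ℝ
  proj_symm : ∀ A : Set ℝ, MeasurableSet A → ∀ x y : 𝓗, ⟪proj A x, y⟫_ℂ = ⟪x, proj A y⟫_ℂ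
  proj_comp : ∀ A B : Set ℝ, MeasurableSet A → MeasurableSet B →
    proj A ∘L proj B = proj (A ∩ B)
  proj_univ : proj Set.univ = ContinuousLinearMap.id ℂ 𝓗
  diag_apply : ∀ (x : 𝓗) (A : Set ℝ), MeasurableSet A →
    diag x A = (‖proj A x‖₊ : ℝ≥0∞) ^ 2

variable {𝓗 : Type*} [NormedAddCommGroup 𝓗] [InnerProductSpace ℂ 𝓗]

/-- The spectrum `σ(H)` (the support of the spectral measure). -/
def SpectralData.spec (P : SpectralData 𝓗) : Set ℝ :=
  {a | ∀ ε > 0, P.proj (Set.Ioo (a - ε) (a + ε)) ≠ 0}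

/-- The essential spectrum `σ_ess(H)` (the points at which every spectral window has
infinite rank). -/
def SpectralData.essSpec (P : SpectralData 𝓗) : Set ℝ :=
  {a | ∀ ε > 0, ¬ FiniteDimensional ℂ ↥(LinearMap.range (P.proj (Set.Ioo (a - ε) (a + ε))).toLinearMap)}

/-- Assumption 1: `E₀` is the ground-state energy of `H`, a simple isolated eigenvalue with
normalized ground state `Ψ₀`. -/
structure IsGroundState (P : SpectralData 𝓗) (E₀ : ℝ) (Ψ₀ : 𝓗) : Prop where
  unit : ‖Ψ₀‖ = 1
  bottom : P.proj (Set.Iio E₀) = 0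
  eig : P.proj {E₀} Ψ₀ = Ψ₀
  simple : LinearMap.range (P.proj {E₀}).toLinearMap = Submodule.span ℂ {Ψ₀}
  isolated : ∃ ε > 0, P.proj (Set.Ioo (E₀ - ε) (E₀ + ε)) = P.proj {E₀}

section Symmetrized

variable {𝓗N 𝓗' : Type*} [NormedAddCommGroup 𝓗N] [InnerProductSpace ℂ 𝓗N]
  [CompleteSpace 𝓗N] [NormedAddCommGroup 𝓗'] [InnerProductSpace ℂ 𝓗'] [CompleteSpace 𝓗']

/-- The set of poles of `χ̂_s` in `D_Ω`: the real `ω ≠ 0` with `|ω| < Ω` and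
`T P^H_{E₀+|ω|} ≠ 0` (Section 4, eq. (4.2)). -/
def chisPoles (P : SpectralData 𝓗N) (E₀ Ω : ℝ) (T : 𝓗N →L[ℂ] 𝓗') : Set ℂ :=
  {z : ℂ | ∃ ω : ℝ, z = (ω : ℂ) ∧ ω ≠ 0 ∧ |ω| < Ω ∧ T ∘L P.proj {E₀ + |ω|} ≠ 0}

/-- `χs` is the symmetrized density-density response function
`χ̂_s(z) = T (∫_{σ(H)} 2(E₀−λ)/((E₀−λ)²−z²) dP^H_λ) T*` of eq. (4.1), characterized (by
polarization) through its quadratic form on `D_Ω` minus the pole set. -/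
def IsSymmetrizedDDRF (P : SpectralData 𝓗N) (E₀ Ω : ℝ) (T : 𝓗N →L[ℂ] 𝓗')
    (χs : ℂ → (𝓗' →L[ℂ] 𝓗')) : Prop :=
  ∀ z ∈ DOmega Ω \ chisPoles P E₀ Ω T, ∀ f : 𝓗',
    Integrable (fun lam : ℝ => (2 * ((E₀ : ℂ) - lam)) / (((E₀ : ℂ) - lam) ^ 2 - z ^ 2))
      (P.diag (T.adjoint f)) ∧
    ⟪f, χs z f⟫_ℂ = ∫ lam : ℝ,
      (2 * ((E₀ : ℂ) - lam)) / (((E₀ : ℂ) - lam) ^ 2 - z ^ 2) ∂(P.diag (T.adjoint f))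

end Symmetrized

/-- The orthogonal projection onto the orthogonal complement of a subspace `V` of a Hilbert
space, as an endomorphism. -/
noncomputable def perpProj {H : Type*} [NormedAddCommGroup H] [InnerProductSpace ℂ H]
    [CompleteSpace H] (V : Submodule ℂ H) : H →L[ℂ] H :=
  haveI : CompleteSpace ↥(Vᗮ) := V.isClosed_orthogonal.completeSpace_coe
  haveI : Submodule.HasOrthogonalProjection (Vᗮ) := Submodule.HasOrthogonalProjection.ofCompleteSpace (K := Vᗮ)
  (Vᗮ).subtypeL ∘L Submodule.orthogonalProjection Vᗮ

/-- The orthogonal projection onto (the closure of) a subspace `V` of a Hilbert space. -/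
noncomputable def projOnto {H : Type*} [NormedAddCommGroup H] [InnerProductSpace ℂ H]
    [CompleteSpace H] (V : Submodule ℂ H) : H →L[ℂ] H :=
  ContinuousLinearMap.id ℂ H - perpProj V

section QuadraticForm

variable {H : Type*} [NormedAddCommGroup H] [InnerProductSpace ℂ H]

theorem isSymmetric_of_inner_self_eq {A : H →L[ℂ] H} {q : H → ℝ}
    (hA : ∀ f, ⟪f, A f⟫_ℂ = (q f : ℂ)) : (A : H →ₗ[ℂ] H).IsSymmetric := by
  rw [LinearMap.isSymmetric_iff_inner_map_self_real]
  intro v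
  have h := hA v
  have h' : ⟪A v, v⟫_ℂ = (q v : ℂ) := by
    rw [← inner_conj_symm, h, Complex.conj_ofReal]
  simp only [ContinuousLinearMap.coe_coe]
  rw [h', Complex.conj_ofReal]

theorem eq_of_inner_self_eq {A B : H →L[ℂ] H} (h : ∀ f, ⟪f, A f⟫_ℂ = ⟪f, B f⟫_ℂ) : A = B := by
  have : (A : H →ₗ[ℂ] H) = (B : H →ₗ[ℂ] H) := by
    rw [← ext_inner_map]
    intro x
    have := congrArg (starRingEnd ℂ) (h x)
    simp only [inner_conj_symm] at this
    exact this
  exact ContinuousLinearMap.coe_injective this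

theorem norm_sub_le_of_inner_self_le {A B : H →L[ℂ] H} {q r : H → ℝ} {C : ℝ} (hC : 0 ≤ C)
    (hA : ∀ f, ⟪f, A f⟫_ℂ = (q f : ℂ)) (hB : ∀ f, ⟪f, B f⟫_ℂ = (r f : ℂ))
    (h : ∀ f, |q f - r f| ≤ C * ‖f‖ ^ 2) : ‖A - B‖ ≤ C := by
  have hAB : ∀ f, ⟪f, (A - B) f⟫_ℂ = ((q f - r f : ℝ) : ℂ) := by
    intro f
    simp [hA, hB]
  have hsym := isSymmetric_of_inner_self_eq hAB
  rw [(A - B).norm_eq_iSup_rayleighQuotient hsym]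
  refine ciSup_le fun x => ?_
  rw [ContinuousLinearMap.rayleighQuotient, ContinuousLinearMap.reApplyInnerSelf_apply]
  rw [inner_re_symm, hAB]
  simp only [RCLike.re_to_complex, Complex.ofReal_re]
  rw [abs_div, abs_of_nonneg (sq_nonneg ‖x‖)]
  exact div_le_of_le_mul₀ (sq_nonneg _) hC (h x)

theorem exists_operator_of_tendsto [CompleteSpace H] {q : H → ℝ} {A : ℕ → H →L[ℂ] H}
    {r : ℕ → H → ℝ} {ε : ℕ → ℝ} (hA : ∀ n f, ⟪f, A n f⟫_ℂ = (r n f : ℂ))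
    (hε : Filter.Tendsto ε Filter.atTop (𝓝 0)) (h : ∀ n f, |r n f - q f| ≤ ε n * ‖f‖ ^ 2) :
    ∃ B : H →L[ℂ] H, ∀ f, ⟪f, B f⟫_ℂ = (q f : ℂ) := by
  have hε' : Filter.Tendsto (fun n => |ε n|) Filter.atTop (𝓝 0) := by simpa using hε.abs
  have hdist : ∀ n m, ‖A n - A m‖ ≤ |ε n| + |ε m| := by
    intro n m
    refine norm_sub_le_of_inner_self_le (by positivity) (hA n) (hA m) fun f => ?_
    have h1 := abs_le.mp (h n f)
    have h2 := abs_le.mp (h m f)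
    have h3 := mul_le_mul_of_nonneg_right (le_abs_self (ε n)) (sq_nonneg ‖f‖)
    have h4 := mul_le_mul_of_nonneg_right (le_abs_self (ε m)) (sq_nonneg ‖f‖)
    rw [abs_le]
    constructor <;> nlinarith
  have hcau : CauchySeq A := by
    rw [Metric.cauchySeq_iff]
    intro δ hδ
    obtain ⟨N, hN⟩ := Filter.eventually_atTop.mp (hε'.eventually_lt_const (half_pos hδ))
    refine ⟨N, fun n hn m hm => ?_⟩
    rw [dist_eq_norm]
    linarith [hdist n m, hN n hn, hN m hm]
  obtain ⟨B, hB⟩ := cauchySeq_tendsto_of_complete hcau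
  refine ⟨B, fun f => ?_⟩
  have h1 : Filter.Tendsto (fun n => ⟪f, A n f⟫_ℂ) Filter.atTop (𝓝 ⟪f, B f⟫_ℂ) := by
    have : Filter.Tendsto (fun n => A n f) Filter.atTop (𝓝 (B f)) :=
      ((ContinuousLinearMap.apply ℂ H f).continuous.tendsto B).comp hB
    exact Filter.Tendsto.inner tendsto_const_nhds this
  have h2 : Filter.Tendsto (fun n => r n f) Filter.atTop (𝓝 (q f)) := by
    rw [tendsto_iff_dist_tendsto_zero]
    refine squeeze_zero (fun _ => dist_nonneg) (fun n => h n f) ?_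
    simpa using hε.mul_const (‖f‖ ^ 2)
  refine tendsto_nhds_unique h1 ?_
  simp_rw [hA]
  exact (Complex.continuous_ofReal.tendsto _).comp h2

theorem exists_inverse_of_one_le [CompleteSpace H] {A : H →L[ℂ] H} {q : H → ℝ}
    (hA : ∀ f, ⟪f, A f⟫_ℂ = (q f : ℂ)) (h : ∀ f, ‖f‖ ^ 2 ≤ q f) :
    ∃ J : H →L[ℂ] H, (∀ f, J (A f) = f) ∧ ∀ f, A (J f) = f := by
  have hu : IsUnit A := by
    refine ContinuousLinearMap.isUnit_of_forall_le_norm_inner_map A (c := 1) one_pos fun x => ?_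
    rw [norm_inner_symm, hA]
    simpa using (h x).trans (le_abs_self _)
  obtain ⟨u, rfl⟩ := hu
  refine ⟨↑u⁻¹, fun f => ?_, fun f => ?_⟩
  · rw [← mul_apply_eq_comp, u.inv_mul, one_apply_eq_self]
  · rw [← mul_apply_eq_comp, u.mul_inv, one_apply_eq_self]

theorem inner_inverse_antitone {A B J K : H →L[ℂ] H} {q r : H → ℝ}
    (hA : ∀ f, ⟪f, A f⟫_ℂ = (q f : ℂ)) (hB : ∀ f, ⟪f, B f⟫_ℂ = (r f : ℂ))
    (hAJ : ∀ f, A (J f) = f) (hBK : ∀ f, B (K f) = f) (hq : ∀ f, 0 ≤ q f)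
    (hqr : ∀ f, q f ≤ r f) (f : H) : (⟪f, K f⟫_ℂ).re ≤ (⟪f, J f⟫_ℂ).re := by
  have h1 := hA (J f - K f)
  have h2 := congrArg Complex.re h1
  have hs := isSymmetric_of_inner_self_eq hA
  have h3 : ⟪J f, A (K f)⟫_ℂ = ⟪f, K f⟫_ℂ := by
    rw [← ContinuousLinearMap.coe_coe A, ← hs, ContinuousLinearMap.coe_coe, hAJ]
  have h4 : (⟪K f, f⟫_ℂ).re = (⟪f, K f⟫_ℂ).re := by
    simpa using (inner_re_symm (𝕜 := ℂ) (K f) f)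
  have h5 : (⟪J f, f⟫_ℂ).re = (⟪f, J f⟫_ℂ).re := by
    simpa using (inner_re_symm (𝕜 := ℂ) (J f) f)
  have h6 := congrArg Complex.re (hB (K f))
  rw [hBK] at h6
  simp only [map_sub, inner_sub_left, inner_sub_right, hA, hAJ, h3, Complex.sub_re,
    Complex.ofReal_re] at h2 h6
  have := hq (J f - K f)
  have := hqr (K f)
  linarith

theorem inverse_isSymmetric {A J : H →L[ℂ] H} {q : H → ℝ}
    (hA : ∀ f, ⟪f, A f⟫_ℂ = (q f : ℂ)) (hAJ : ∀ f, A (J f) = f) (f g : H) :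
    ⟪J f, g⟫_ℂ = ⟪f, J g⟫_ℂ := by
  have hs := isSymmetric_of_inner_self_eq hA (J f) (J g)
  simpa [hAJ] using hs.symm

/-- The kernels of a family of symmetric operators whose quadratic forms on `W` strictly decrease
with `r` have total dimension at most `dim W`. -/
theorem sum_finrank_ker_le_of_strictAnti {ι : Type*} (W : Submodule ℂ H)
    [FiniteDimensional ℂ W] (Q : ι → H →L[ℂ] H) (N : ι → Submodule ℂ H) (r : ι → ℝ) (I : Set ι)
    (hsymm : ∀ x ∈ I, ∀ c d, ⟪Q x c, d⟫_ℂ = ⟪c, Q x d⟫_ℂ)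
    (hanti : ∀ x ∈ I, ∀ y ∈ I, r x < r y → ∀ c ∈ W, c ≠ 0 →
      (⟪c, Q y c⟫_ℂ).re < (⟪c, Q x c⟫_ℂ).re)
    (hNW : ∀ x, N x ≤ W) (hN : ∀ x ∈ I, ∀ c ∈ N x, Q x c = 0)
    (S : Finset ι) (hS : ∀ x ∈ S, x ∈ I) (hinj : Set.InjOn r S) :
    ∑ x ∈ S, Module.finrank ℂ (N x) ≤ Module.finrank ℂ W := by
  classical
  suffices h : ∀ S' : Finset ι, S' ⊆ S → ∃ V : Submodule ℂ H, V ≤ W ∧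
      Module.finrank ℂ V = ∑ x ∈ S', Module.finrank ℂ (N x) ∧
      ∀ x ∈ I, (∀ s ∈ S', r s < r x) → ∀ c ∈ V, c ≠ 0 → (⟪c, Q x c⟫_ℂ).re < 0 by
    obtain ⟨V, hV, hVd, -⟩ := h S subset_rfl
    rw [← hVd]
    exact Submodule.finrank_mono hV
  intro S'
  induction S' using Finset.induction_on_max_value r with
  | empty => exact fun _ => ⟨⊥, bot_le, by simp, by simp⟩
  | insert t S' ht hmax ih =>
    intro hsub
    have htS : t ∈ S := hsub (Finset.mem_insert_self _ _)
    have hS'S : S' ⊆ S := fun x hx => hsub (Finset.mem_insert_of_mem hx)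
    obtain ⟨V, hVW, hVd, hneg⟩ := ih hS'S
    have hlt : ∀ s ∈ S', r s < r t := fun s hs =>
      lt_of_le_of_ne (hmax s hs) fun h => ht (hinj (hS'S hs) htS h ▸ hs)
    have htI := hS t htS
    have hVt := hneg t htI hlt
    have : FiniteDimensional ℂ V := Submodule.finiteDimensional_of_le hVW
    have : FiniteDimensional ℂ (N t) := Submodule.finiteDimensional_of_le (hNW t)
    have hinf : V ⊓ N t = ⊥ := by
      rw [Submodule.eq_bot_iff]
      rintro c ⟨hcV, hcN⟩
      by_contra hc
      have := hVt c hcV hc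
      simp [hN t htI c hcN] at this
    refine ⟨V ⊔ N t, sup_le hVW (hNW t), ?_, ?_⟩
    · have := Submodule.finrank_sup_add_finrank_inf_eq V (N t)
      rw [hinf, finrank_bot] at this
      rw [Finset.sum_insert ht]
      omega
    · intro x hxI hx c hc hc0
      have hcW : c ∈ W := sup_le hVW (hNW t) hc
      refine (hanti t htI x hxI (hx t (Finset.mem_insert_self _ _)) c hcW hc0).trans_le ?_
      obtain ⟨v, hv, n, hn, rfl⟩ := Submodule.mem_sup.mp hc
      have hQn := hN t htI n hn
      have hnv : ⟪n, Q t v⟫_ℂ = 0 := by rw [← hsymm t htI, hQn, inner_zero_left]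
      rw [map_add, hQn, add_zero, inner_add_left, hnv, add_zero]
      by_cases hv0 : v = 0
      · simp [hv0]
      · exact (hVt v hv hv0).le

end QuadraticForm

namespace SpectralData

section Basic

variable (P : SpectralData 𝓗)

theorem diag_real (x : 𝓗) {A : Set ℝ} (hA : MeasurableSet A) :
    (P.diag x).real A = ‖P.proj A x‖ ^ 2 := by
  simp [Measure.real, P.diag_apply x A hA]

instance isFiniteMeasure_diag (x : 𝓗) : IsFiniteMeasure (P.diag x) :=
  ⟨by rw [P.diag_apply x _ MeasurableSet.univ]; exact ENNReal.pow_lt_top ENNReal.coe_lt_top⟩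

theorem diag_real_univ (x : 𝓗) : (P.diag x).real Set.univ = ‖x‖ ^ 2 := by
  rw [P.diag_real x MeasurableSet.univ, P.proj_univ, ContinuousLinearMap.id_apply]

theorem diag_eq_zero_iff (x : 𝓗) {A : Set ℝ} (hA : MeasurableSet A) :
    P.diag x A = 0 ↔ P.proj A x = 0 := by
  simp [P.diag_apply x A hA]

theorem proj_empty : P.proj ∅ = 0 := by
  ext x
  simpa using (P.diag_eq_zero_iff x MeasurableSet.empty).mp measure_empty

theorem proj_proj {A B : Set ℝ} (hA : MeasurableSet A) (hB : MeasurableSet B) (x : 𝓗) :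
    P.proj A (P.proj B x) = P.proj (A ∩ B) x := by
  rw [← P.proj_comp A B hA hB, ContinuousLinearMap.comp_apply]

theorem proj_idem {A : Set ℝ} (hA : MeasurableSet A) (x : 𝓗) :
    P.proj A (P.proj A x) = P.proj A x := by
  rw [P.proj_proj hA hA, Set.inter_self]

theorem inner_proj_self {A : Set ℝ} (hA : MeasurableSet A) (x : 𝓗) :
    ⟪x, P.proj A x⟫_ℂ = ((‖P.proj A x‖ ^ 2 : ℝ) : ℂ) := by
  rw [← P.proj_idem hA, ← P.proj_symm A hA, inner_self_eq_norm_sq_to_K, P.proj_idem hA]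
  push_cast
  rfl

theorem range_proj_mono {A B : Set ℝ} (hA : MeasurableSet A) (hB : MeasurableSet B) (h : A ⊆ B) :
    LinearMap.range (P.proj A).toLinearMap ≤ LinearMap.range (P.proj B).toLinearMap := by
  rintro _ ⟨x, rfl⟩
  refine ⟨P.proj A x, ?_⟩
  simp only [ContinuousLinearMap.coe_coe]
  rw [P.proj_proj hB hA, Set.inter_eq_right.mpr h]

/-- Points outside the essential spectrum are isolated in the spectrum. -/
theorem exists_proj_punctured_eq_zero {a : ℝ} (ha : a ∉ P.essSpec) :
    ∃ ε > 0, P.proj (Set.Ioo (a - ε) (a + ε) \ {a}) = 0 := by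
  simp only [essSpec, Set.mem_ofPred_eq, not_forall, not_not] at ha
  obtain ⟨ε, hε, hfd⟩ := ha
  set A : ℕ → Set ℝ := fun n => Set.Ioo (a - ε / (n + 1)) (a + ε / (n + 1)) \ {a} with hA
  have hAm : ∀ n, MeasurableSet (A n) := fun n => measurableSet_Ioo.diff (measurableSet_singleton a)
  have hanti : Antitone A := by
    intro n m hnm
    have : ε / ((m : ℝ) + 1) ≤ ε / (n + 1) := by gcongr
    exact Set.sdiff_subset_sdiff_left (Set.Ioo_subset_Ioo (by linarith) (by linarith))
  set V : ℕ → Submodule ℂ 𝓗 := fun n => LinearMap.range (P.proj (A n)).toLinearMap with hV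
  have hfdV : ∀ n, FiniteDimensional ℂ (V n) := by
    intro n
    refine Submodule.finiteDimensional_of_le
      (P.range_proj_mono (hAm n) (measurableSet_Ioo (a := a - ε) (b := a + ε)) ?_)
    have : ε / ((n : ℝ) + 1) ≤ ε := div_le_self hε.le (by simp)
    exact Set.sdiff_subset.trans (Set.Ioo_subset_Ioo (by linarith) (by linarith))
  obtain ⟨_, ⟨n, rfl⟩, hn⟩ := WellFounded.has_min (wellFounded_lt (α := ℕ))
    (Set.range fun n => Module.finrank ℂ (V n)) (Set.range_nonempty _)
  refine ⟨ε / (n + 1), by positivity, ?_⟩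
  ext y
  have hmem : ∀ m, n ≤ m → P.proj (A m) (P.proj (A n) y) = P.proj (A n) y := by
    intro m hm
    have := Submodule.eq_of_le_of_finrank_le (P.range_proj_mono (hAm m) (hAm n) (hanti hm))
      (not_lt.mp (hn _ ⟨m, rfl⟩))
    have hy : P.proj (A n) y ∈ V m := by
      simp only [hV]
      rw [this]
      exact ⟨y, rfl⟩
    obtain ⟨z, hz⟩ := hy
    rw [← hz]
    exact P.proj_idem (hAm m) z
  have hinter : ⋂ m, A m = ∅ := by
    rw [Set.eq_empty_iff_forall_notMem]
    intro b hb
    rw [Set.mem_iInter] at hb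
    have hne : b ≠ a := (hb 0).2
    obtain ⟨m, hm⟩ := exists_nat_gt (ε / |b - a|)
    have hpos : 0 < |b - a| := abs_pos.mpr (sub_ne_zero.mpr hne)
    have h1 := (hb m).1
    have h2 : |b - a| < ε / (m + 1) := by
      rw [abs_lt]
      exact ⟨by linarith [h1.1], by linarith [h1.2]⟩
    rw [div_lt_iff₀ hpos] at hm
    rw [lt_div_iff₀ (by positivity)] at h2
    nlinarith
  have hlim := tendsto_measure_iInter_atTop (μ := P.diag (P.proj (A n) y)) (s := A)
    (fun m => (hAm m).nullMeasurableSet) hanti ⟨0, measure_ne_top _ _⟩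
  rw [hinter, measure_empty] at hlim
  have hconst : ∀ᶠ m in Filter.atTop, P.diag (P.proj (A n) y) (A m) =
      (‖P.proj (A n) y‖₊ : ℝ≥0∞) ^ 2 := by
    filter_upwards [Filter.eventually_ge_atTop n] with m hm
    rw [P.diag_apply _ _ (hAm m), hmem m hm]
  have := tendsto_nhds_unique (hlim.congr' hconst) tendsto_const_nhds
  simpa using this.symm

end Basic

section GroundState

variable {P : SpectralData 𝓗} {E₀ : ℝ} {Ψ₀ : 𝓗}

theorem notMem_essSpec_of_lt (hgs : IsGroundState P E₀ Ψ₀) {a : ℝ}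
    (ha : a < sInf P.essSpec) : a ∉ P.essSpec := by
  refine fun h => (csInf_le ⟨E₀, fun b hb => ?_⟩ h).not_gt ha
  by_contra! hlt
  refine hb (E₀ - b) (by linarith) ?_
  have : P.proj (Set.Ioo (b - (E₀ - b)) (b + (E₀ - b))) = 0 := by
    rw [show Set.Ioo (b - (E₀ - b)) (b + (E₀ - b)) =
      Set.Ioo (b - (E₀ - b)) (b + (E₀ - b)) ∩ Set.Iio E₀ by
        rw [Set.inter_eq_left.mpr]; intro x hx; simpa using hx.2,
      ← P.proj_comp _ _ measurableSet_Ioo measurableSet_Iio, hgs.bottom,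
      ContinuousLinearMap.comp_zero]
  have hbot : LinearMap.range (0 : 𝓗 →L[ℂ] 𝓗).toLinearMap = ⊥ := LinearMap.range_zero
  rw [this, hbot]
  infer_instance

/-- Below the essential spectrum, diagonal spectral measures live on their atoms. -/
theorem diag_eq_zero_of_forall_atom (hgs : IsGroundState P E₀ Ψ₀) (y : 𝓗) {A : Set ℝ}
    (hA : ∀ a ∈ A, a < sInf P.essSpec) (hy : ∀ a ∈ A, P.proj {a} y = 0) : P.diag y A = 0 := by
  refine measure_null_of_locally_null A fun a ha => ?_
  obtain ⟨ε, hε, h0⟩ := P.exists_proj_punctured_eq_zero (notMem_essSpec_of_lt hgs (hA a ha))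
  refine ⟨Set.Ioo (a - ε) (a + ε),
    mem_nhdsWithin_of_mem_nhds (Ioo_mem_nhds (by linarith) (by linarith)), ?_⟩
  have h1 : P.diag y (Set.Ioo (a - ε) (a + ε) \ {a}) = 0 := by
    rw [P.diag_eq_zero_iff y (measurableSet_Ioo.diff (measurableSet_singleton a)), h0]
    rfl
  have h2 : P.diag y {a} = 0 := by
    rw [P.diag_eq_zero_iff y (measurableSet_singleton a), hy a ha]
  refine measure_mono_null (fun b hb => ?_) (measure_union_null h1 h2)
  by_cases hba : b = a
  · exact Or.inr hba
  · exact Or.inl ⟨hb, hba⟩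

end GroundState

end SpectralData

section FarKernel

variable {E₀ ω x y lam : ℝ}

/-- The negative of the integrand of the symmetrized response function at a real frequency. -/
def farKernel (E₀ x lam : ℝ) : ℝ := 2 * (lam - E₀) / ((lam - E₀) ^ 2 - x ^ 2)

theorem measurable_farKernel (E₀ x : ℝ) : Measurable (farKernel E₀ x) := by
  unfold farKernel
  fun_prop

theorem sq_lt_sq_of_abs_lt (hx : |x| < ω) (hlam : E₀ + ω ≤ lam) : x ^ 2 < (lam - E₀) ^ 2 := by
  rw [sq_lt_sq]
  exact hx.trans_le ((by linarith : ω ≤ lam - E₀).trans (le_abs_self _))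

theorem farKernel_nonneg (hx : |x| < ω) (hlam : E₀ + ω ≤ lam) : 0 ≤ farKernel E₀ x lam := by
  have := sq_lt_sq_of_abs_lt hx hlam
  have := abs_nonneg x
  exact div_nonneg (by linarith) (by linarith)

theorem farKernel_mono (hxy : |x| ≤ |y|) (hy : |y| < ω) (hlam : E₀ + ω ≤ lam) :
    farKernel E₀ x lam ≤ farKernel E₀ y lam := by
  have h1 := sq_lt_sq_of_abs_lt hy hlam
  have h2 := sq_le_sq.mpr hxy
  have := abs_nonneg y
  exact div_le_div_of_nonneg_left (by linarith) (by linarith) (by linarith)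

theorem abs_farKernel_sub_le {r : ℝ} (hr : r < ω) (hx : |x| ≤ r) (hy : |y| ≤ r)
    (hlam : E₀ + ω ≤ lam) : |farKernel E₀ x lam - farKernel E₀ y lam| ≤
      2 * |x ^ 2 - y ^ 2| / ((ω - r) * (ω ^ 2 - r ^ 2)) := by
  have hr0 : 0 ≤ r := (abs_nonneg x).trans hx
  have hx2 : x ^ 2 ≤ r ^ 2 := sq_le_sq.mpr (by rwa [abs_of_nonneg hr0])
  have hy2 : y ^ 2 ≤ r ^ 2 := sq_le_sq.mpr (by rwa [abs_of_nonneg hr0])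
  unfold farKernel
  set a := lam - E₀ with ha
  have haω : ω ≤ a := by linarith
  have ha0 : 0 < a := by linarith
  have h1 : a * (ω - r) ≤ a ^ 2 - x ^ 2 := by nlinarith
  have h2 : ω ^ 2 - r ^ 2 ≤ a ^ 2 - y ^ 2 := by nlinarith
  have h3 : 0 < ω ^ 2 - r ^ 2 := by nlinarith
  have h4 : 0 < a * (ω - r) := mul_pos ha0 (by linarith)
  have hX : 0 < a ^ 2 - x ^ 2 := by linarith
  have hY : 0 < a ^ 2 - y ^ 2 := by linarith
  have h5 : 2 * a / (a ^ 2 - x ^ 2) - 2 * a / (a ^ 2 - y ^ 2) =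
      2 * a * (x ^ 2 - y ^ 2) / ((a ^ 2 - x ^ 2) * (a ^ 2 - y ^ 2)) := by
    field_simp
    ring
  rw [h5, abs_div, abs_mul, abs_of_pos (mul_pos hX hY), abs_of_pos (by linarith : 0 < 2 * a)]
  calc 2 * a * |x ^ 2 - y ^ 2| / ((a ^ 2 - x ^ 2) * (a ^ 2 - y ^ 2))
      ≤ 2 * a * |x ^ 2 - y ^ 2| / ((a * (ω - r)) * (ω ^ 2 - r ^ 2)) := by gcongr
    _ = 2 * |x ^ 2 - y ^ 2| / ((ω - r) * (ω ^ 2 - r ^ 2)) := by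
      have : ω - r ≠ 0 := by linarith
      field_simp

theorem integrableOn_farKernel (μ : Measure ℝ) [IsFiniteMeasure μ] (hx : |x| < ω) :
    IntegrableOn (farKernel E₀ x) (Set.Ici (E₀ + ω)) μ := by
  have hω : 0 < ω := (abs_nonneg x).trans_lt hx
  refine IntegrableOn.of_bound (measure_lt_top _ _) (measurable_farKernel E₀ x).aestronglyMeasurable
    (2 / (ω - |x|)) ?_
  filter_upwards [ae_restrict_mem measurableSet_Ici] with lam hlam
  rw [Real.norm_of_nonneg (farKernel_nonneg hx hlam), farKernel]
  have h1 := sq_lt_sq_of_abs_lt hx hlam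
  have h2 : ω ≤ lam - E₀ := by linarith [Set.mem_Ici.mp hlam]
  have h3 : |x| ^ 2 = x ^ 2 := sq_abs x
  have h4 := abs_nonneg x
  rw [div_le_div_iff₀ (by linarith) (by linarith)]
  nlinarith

end FarKernel

section FarForm

variable {𝓗N : Type*} [NormedAddCommGroup 𝓗N] [InnerProductSpace ℂ 𝓗N] [CompleteSpace 𝓗N]
  {𝓗' : Type*} [NormedAddCommGroup 𝓗'] [InnerProductSpace ℂ 𝓗'] [CompleteSpace 𝓗']
  (P : SpectralData 𝓗N) (E₀ ω : ℝ) (T : 𝓗N →L[ℂ] 𝓗')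

/-- The quadratic form of `1 − χ̂_s(x)` after discarding the spectrum of `H` below `E₀ + ω`. -/
def farForm (x : ℝ) (f : 𝓗') : ℝ :=
  ‖f‖ ^ 2 + ∫ lam in Set.Ici (E₀ + ω), farKernel E₀ x lam ∂P.diag (T.adjoint f)

variable {E₀ ω}

theorem sq_norm_le_farForm {x : ℝ} (hx : |x| < ω) (f : 𝓗') : ‖f‖ ^ 2 ≤ farForm P E₀ ω T x f :=
  le_add_of_nonneg_right
    (setIntegral_nonneg measurableSet_Ici fun _ hlam => farKernel_nonneg hx hlam)

theorem farForm_mono {x y : ℝ} (hxy : |x| ≤ |y|) (hy : |y| < ω) (f : 𝓗') :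
    farForm P E₀ ω T x f ≤ farForm P E₀ ω T y f := by
  unfold farForm
  gcongr 1
  exact setIntegral_mono_on (integrableOn_farKernel _ (hxy.trans_lt hy))
    (integrableOn_farKernel _ hy) measurableSet_Ici fun _ hlam => farKernel_mono hxy hy hlam

theorem abs_farForm_sub_le {x y r : ℝ} (hr : r < ω) (hx : |x| ≤ r) (hy : |y| ≤ r) (f : 𝓗') :
    |farForm P E₀ ω T x f - farForm P E₀ ω T y f| ≤
      2 * |x ^ 2 - y ^ 2| / ((ω - r) * (ω ^ 2 - r ^ 2)) * ‖T.adjoint‖ ^ 2 * ‖f‖ ^ 2 := by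
  have hr0 : 0 ≤ r := (abs_nonneg x).trans hx
  have hC : 0 ≤ 2 * |x ^ 2 - y ^ 2| / ((ω - r) * (ω ^ 2 - r ^ 2)) := by
    have : 0 < ω - r := by linarith
    have : 0 < ω ^ 2 - r ^ 2 := by nlinarith
    positivity
  unfold farForm
  rw [add_sub_add_left_eq_sub, ← integral_sub (integrableOn_farKernel _ (hx.trans_lt hr))
    (integrableOn_farKernel _ (hy.trans_lt hr)), ← Real.norm_eq_abs]
  refine (norm_setIntegral_le_of_norm_le_const (measure_lt_top _ _)
    fun lam hlam => abs_farKernel_sub_le hr hx hy hlam).trans ?_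
  rw [mul_assoc]
  refine mul_le_mul_of_nonneg_left ?_ hC
  calc (P.diag (T.adjoint f)).real (Set.Ici (E₀ + ω))
      ≤ (P.diag (T.adjoint f)).real Set.univ := measureReal_mono (Set.subset_univ _)
    _ = ‖T.adjoint f‖ ^ 2 := P.diag_real_univ _
    _ ≤ (‖T.adjoint‖ * ‖f‖) ^ 2 := by gcongr; exact T.adjoint.le_opNorm f
    _ = ‖T.adjoint‖ ^ 2 * ‖f‖ ^ 2 := mul_pow _ _ _

end FarForm

section FarOperator

variable {𝓗N : Type*} [NormedAddCommGroup 𝓗N] [InnerProductSpace ℂ 𝓗N] [CompleteSpace 𝓗N]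
  {𝓗' : Type*} [NormedAddCommGroup 𝓗'] [InnerProductSpace ℂ 𝓗'] [CompleteSpace 𝓗']
  {P : SpectralData 𝓗N} {E₀ ω Ω : ℝ} {T : 𝓗N →L[ℂ] 𝓗'}

theorem proj_adjoint_eq_zero {A : Set ℝ} (hA : MeasurableSet A) (h : T ∘L P.proj A = 0) (f : 𝓗') :
    P.proj A (T.adjoint f) = 0 := by
  refine ext_inner_left ℂ fun w => ?_
  rw [← P.proj_symm A hA, ContinuousLinearMap.adjoint_inner_right,
    ← ContinuousLinearMap.comp_apply, h]
  simp

/-- The part of `1 − χ̂_s(x)` coming from the excitation energies in `S`. -/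
def nearOp (P : SpectralData 𝓗N) (E₀ : ℝ) (T : 𝓗N →L[ℂ] 𝓗') (S : Finset ℝ) (x : ℝ) :
    𝓗' →L[ℂ] 𝓗' :=
  ∑ a ∈ S, ((2 * a / (a ^ 2 - x ^ 2) : ℝ) : ℂ) • (T ∘L P.proj {E₀ + a} ∘L T.adjoint)

theorem inner_nearOp (S : Finset ℝ) (x : ℝ) (f : 𝓗') : ⟪f, nearOp P E₀ T S x f⟫_ℂ =
    ((∑ a ∈ S, 2 * a / (a ^ 2 - x ^ 2) * ‖P.proj {E₀ + a} (T.adjoint f)‖ ^ 2 : ℝ) : ℂ) := by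
  simp only [nearOp, sum_apply, smul_apply,
    ContinuousLinearMap.comp_apply, inner_sum, inner_smul_right]
  push_cast
  refine Finset.sum_congr rfl fun a _ => ?_
  rw [← ContinuousLinearMap.adjoint_inner_left, P.inner_proj_self (measurableSet_singleton _)]
  push_cast
  rfl

theorem integral_farKernel_eq {Ψ₀ : 𝓗N} (hgs : IsGroundState P E₀ Ψ₀)
    (hω : E₀ + ω ≤ sInf P.essSpec) {S : Finset ℝ}
    (hS : ∀ a, a ∈ S ↔ 0 < a ∧ a < ω ∧ T ∘L P.proj {E₀ + a} ≠ 0) {x : ℝ} (hx : |x| < ω)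
    (f : 𝓗') : ∫ lam, farKernel E₀ x lam ∂P.diag (T.adjoint f) =
      ∑ a ∈ S, 2 * a / (a ^ 2 - x ^ 2) * ‖P.proj {E₀ + a} (T.adjoint f)‖ ^ 2 +
        ∫ lam in Set.Ici (E₀ + ω), farKernel E₀ x lam ∂P.diag (T.adjoint f) := by
  classical
  have hω0 : 0 < ω := (abs_nonneg x).trans_lt hx
  set μ := P.diag (T.adjoint f) with hμ
  set Z : Set ℝ := ⋃ a ∈ insert 0 S, {E₀ + a} with hZ
  have hmemZ : ∀ lam, lam ∈ Z ↔ lam = E₀ ∨ lam - E₀ ∈ S := by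
    intro lam
    simp only [hZ, Finset.mem_insert, Set.mem_iUnion, Set.mem_singleton_iff, exists_prop]
    constructor
    · rintro ⟨a, rfl | ha, rfl⟩
      · simp
      · right; simpa using ha
    · rintro (rfl | h)
      · exact ⟨0, by simp⟩
      · exact ⟨lam - E₀, Or.inr h, by ring⟩
  have hlow : μ (Set.Iio E₀) = 0 := by
    rw [P.diag_eq_zero_iff _ measurableSet_Iio, hgs.bottom]
    rfl
  have hmid : μ {lam | E₀ < lam ∧ lam < E₀ + ω ∧ lam - E₀ ∉ S} = 0 := by
    refine SpectralData.diag_eq_zero_of_forall_atom hgs _ (fun a ha => ha.2.1.trans_le hω) ?_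
    rintro a ⟨h1, h2, h3⟩
    refine proj_adjoint_eq_zero (measurableSet_singleton _) ?_ f
    by_contra hne
    refine h3 ((hS _).mpr ⟨by linarith, by linarith, ?_⟩)
    rwa [add_sub_cancel]
  have hae : ∀ᵐ lam ∂μ, lam ∈ Z ∪ Set.Ici (E₀ + ω) := by
    rw [ae_iff]
    refine measure_mono_null (fun lam hlam => ?_) (measure_union_null hlow hmid)
    simp only [Set.mem_ofPred_eq, Set.mem_union, hmemZ, Set.mem_Ici, not_or, not_le] at hlam
    rcases lt_or_gt_of_ne hlam.1.1 with h | h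
    · exact Or.inl h
    · exact Or.inr ⟨h, hlam.2, hlam.1.2⟩
  have hdisj : Disjoint Z (Set.Ici (E₀ + ω)) := by
    rw [Set.disjoint_left]
    intro lam h1 h2
    rw [Set.mem_Ici] at h2
    rcases (hmemZ lam).mp h1 with rfl | h
    · linarith
    · linarith [((hS _).mp h).2.1]
  have hint : ∀ a ∈ insert 0 S, IntegrableOn (farKernel E₀ x) {E₀ + a} μ := fun a _ =>
    integrableOn_singleton (hx := measure_lt_top _ _)
  have h0 : (0 : ℝ) ∉ S := fun h => lt_irrefl _ ((hS 0).mp h).1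
  conv_lhs => rw [← Measure.restrict_eq_self_of_ae_mem hae]
  rw [setIntegral_union hdisj measurableSet_Ici (integrableOn_finset_iUnion.mpr hint)
    (integrableOn_farKernel μ hx), hZ, integral_biUnion_finset _
    (fun a _ => measurableSet_singleton _) ?_ hint, Finset.sum_insert h0]
  · congr 1
    simp only [integral_singleton, smul_eq_mul]
    rw [show farKernel E₀ x (E₀ + 0) = 0 by simp [farKernel], mul_zero, zero_add]
    refine Finset.sum_congr rfl fun a _ => ?_
    rw [hμ, P.diag_real _ (measurableSet_singleton _), farKernel, add_sub_cancel_left, mul_comm]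
  · intro a _ b _ hab
    simpa [Function.onFun] using hab

theorem inner_one_sub_sub_nearOp {Ψ₀ : 𝓗N} (hgs : IsGroundState P E₀ Ψ₀)
    (hω : E₀ + ω ≤ sInf P.essSpec) {S : Finset ℝ}
    (hS : ∀ a, a ∈ S ↔ 0 < a ∧ a < ω ∧ T ∘L P.proj {E₀ + a} ≠ 0) {χs : ℂ → 𝓗' →L[ℂ] 𝓗'}
    (hχs : IsSymmetrizedDDRF P E₀ Ω T χs) {x : ℝ} (hx : |x| < ω)
    (hreg : (x : ℂ) ∈ DOmega Ω \ chisPoles P E₀ Ω T) (f : 𝓗') :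
    ⟪f, (1 - χs x - nearOp P E₀ T S x) f⟫_ℂ = (farForm P E₀ ω T x f : ℂ) := by
  have h1 : ⟪f, χs x f⟫_ℂ =
      ((-∫ lam, farKernel E₀ x lam ∂P.diag (T.adjoint f) : ℝ) : ℂ) := by
    rw [(hχs x hreg f).2, ← integral_neg, ← integral_complex_ofReal]
    congr 1
    ext lam
    rw [farKernel, ← neg_div]
    push_cast
    ring_nf
  rw [sub_apply, sub_apply, one_apply_eq_self,
    inner_sub_right, inner_sub_right, h1, inner_nearOp, integral_farKernel_eq hgs hω hS hx,
    inner_self_eq_norm_sq_to_K, farForm]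
  push_cast
  simp only [Complex.coe_algebraMap]
  ring

omit [CompleteSpace 𝓗N] [CompleteSpace 𝓗'] in
theorem mem_regular (hωΩ : ω ≤ Ω) {S : Finset ℝ}
    (hS : ∀ a, a ∈ S ↔ 0 < a ∧ a < ω ∧ T ∘L P.proj {E₀ + a} ≠ 0) {x : ℝ} (hx : |x| < ω)
    (hxS : |x| ∉ S) : (x : ℂ) ∈ DOmega Ω \ chisPoles P E₀ Ω T := by
  refine ⟨Or.inr (by simpa using hx.trans_le hωΩ), ?_⟩
  rintro ⟨y, hxy, hy0, -, hT⟩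
  obtain rfl : x = y := by exact_mod_cast hxy
  exact hxS ((hS _).mpr ⟨abs_pos.mpr hy0, hx, hT⟩)

theorem eventually_abs_notMem (S : Finset ℝ) (x : ℝ) : ∀ᶠ y in 𝓝[≠] x, |y| ∉ S := by
  have hfin : ({y : ℝ | |y| ∈ S} : Set ℝ).Finite := by
    refine (S.finite_toSet.union (S.finite_toSet.image Neg.neg)).subset fun y hy => ?_
    rcases abs_choice y with h | h
    · left; simpa [h] using hy
    · right; exact ⟨-y, by simpa [h] using hy, by simp⟩
  have := hfin.isClosed.isOpen_compl
  have h2 := (hfin.subset (Set.sdiff_subset (t := {x}))).isClosed.isOpen_compl.mem_nhds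
    (show x ∈ ({y : ℝ | |y| ∈ S} \ {x})ᶜ by simp)
  filter_upwards [mem_nhdsWithin_of_mem_nhds h2, self_mem_nhdsWithin] with y hy hyx hyS
  exact hy ⟨hyS, hyx⟩

/-- The coefficient in `abs_farForm_sub_le` tends to zero. -/
theorem tendsto_farForm_modulus (r C x₀ : ℝ) : Filter.Tendsto
    (fun x : ℝ => 2 * |x ^ 2 - x₀ ^ 2| / ((ω - r) * (ω ^ 2 - r ^ 2)) * C) (𝓝 x₀) (𝓝 0) := by
  have h : Continuous
      (fun x : ℝ => 2 * |x ^ 2 - x₀ ^ 2| / ((ω - r) * (ω ^ 2 - r ^ 2)) * C) := by fun_prop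
  simpa using h.tendsto x₀

theorem eventually_abs_le {x₀ r : ℝ} (h : |x₀| < r) : ∀ᶠ x : ℝ in 𝓝 x₀, |x| ≤ r :=
  (continuous_abs.tendsto x₀).eventually_le_const h

theorem exists_farOp {Ψ₀ : 𝓗N} (hgs : IsGroundState P E₀ Ψ₀)
    (hω : E₀ + ω ≤ sInf P.essSpec) (hωΩ : ω ≤ Ω) {S : Finset ℝ}
    (hS : ∀ a, a ∈ S ↔ 0 < a ∧ a < ω ∧ T ∘L P.proj {E₀ + a} ≠ 0) {χs : ℂ → 𝓗' →L[ℂ] 𝓗'}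
    (hχs : IsSymmetrizedDDRF P E₀ Ω T χs) {x₀ : ℝ} (hx₀ : |x₀| < ω) :
    ∃ B : 𝓗' →L[ℂ] 𝓗', ∀ f, ⟪f, B f⟫_ℂ = (farForm P E₀ ω T x₀ f : ℂ) := by
  obtain ⟨r, hr1, hr2⟩ := exists_between hx₀
  have hev : ∀ᶠ x in 𝓝[≠] x₀, |x| ≤ r ∧ |x| ∉ S :=
    ((eventually_abs_le hr1).filter_mono nhdsWithin_le_nhds).and (eventually_abs_notMem S x₀)
  obtain ⟨u, hu, hu'⟩ := Filter.exists_seq_forall_of_frequently hev.frequently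
  refine exists_operator_of_tendsto (A := fun n => 1 - χs (u n) - nearOp P E₀ T S (u n))
    (r := fun n => farForm P E₀ ω T (u n))
    (fun n f => inner_one_sub_sub_nearOp hgs hω hS hχs ((hu' n).1.trans_lt hr2)
      (mem_regular hωΩ hS ((hu' n).1.trans_lt hr2) (hu' n).2) f)
    ((tendsto_farForm_modulus (ω := ω) r (‖T.adjoint‖ ^ 2) x₀).comp
      (hu.mono_right nhdsWithin_le_nhds))
    (fun n f => abs_farForm_sub_le P T hr2 (hu' n).1 hr1.le f)

theorem tendsto_farOp {Φ : ℝ → 𝓗' →L[ℂ] 𝓗'}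
    (hΦ : ∀ x, |x| < ω → ∀ f, ⟪f, Φ x f⟫_ℂ = (farForm P E₀ ω T x f : ℂ)) {x₀ : ℝ}
    (hx₀ : |x₀| < ω) : Filter.Tendsto Φ (𝓝 x₀) (𝓝 (Φ x₀)) := by
  obtain ⟨r, hr1, hr2⟩ := exists_between hx₀
  rw [tendsto_iff_norm_sub_tendsto_zero]
  refine squeeze_zero' (Filter.Eventually.of_forall fun _ => norm_nonneg _) ?_
    (tendsto_farForm_modulus (ω := ω) r (‖T.adjoint‖ ^ 2) x₀)
  filter_upwards [eventually_abs_le hr1] with x hx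
  have h0 : 0 ≤ r := (abs_nonneg _).trans hx
  refine norm_sub_le_of_inner_self_le ?_ (hΦ x (hx.trans_lt hr2)) (hΦ x₀ hx₀)
    fun f => abs_farForm_sub_le P T hr2 hx hr1.le f
  have : 0 < ω - r := by linarith
  have : 0 < ω ^ 2 - r ^ 2 := by nlinarith
  positivity

end FarOperator

section Pole

variable {E F : Type*} [NormedAddCommGroup E] [NormedSpace ℂ E]
  [NormedAddCommGroup F] [NormedSpace ℂ F] {K : ℂ → E →L[ℂ] F} {z₀ : ℂ} {R : E →L[ℂ] F}

theorem SimplePoleAt.tendsto_smul (h : SimplePoleAt K z₀ R) :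
    Filter.Tendsto (fun z => (z - z₀) • K z) (𝓝[≠] z₀) (𝓝 R) := by
  obtain ⟨-, -, K₀, U, hU, hz₀, hK₀, hK⟩ := h
  have h1 : ContinuousAt (fun z => (z - z₀) • K₀ z + R) z₀ := by
    have := (hK₀ z₀ hz₀).continuousAt
    fun_prop
  have h2 := h1.tendsto.mono_left (nhdsWithin_le_nhds (s := {z₀}ᶜ))
  simp only [sub_self, zero_smul, zero_add] at h2
  refine h2.congr' ?_
  filter_upwards [mem_nhdsWithin_of_mem_nhds (hU.mem_nhds hz₀), self_mem_nhdsWithin] with z hz hne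
  rw [hK z hz hne, smul_add, smul_inv_smul₀ (sub_ne_zero.mpr hne)]

theorem SimplePoleAt.eventually_analyticAt (h : SimplePoleAt K z₀ R) :
    ∀ᶠ z in 𝓝[≠] z₀, AnalyticAt ℂ K z := by
  obtain ⟨-, -, K₀, U, hU, hz₀, hK₀, hK⟩ := h
  filter_upwards [mem_nhdsWithin_of_mem_nhds (hU.mem_nhds hz₀), self_mem_nhdsWithin] with z hz hne
  have h1 : AnalyticAt ℂ (fun w => K₀ w + (w - z₀)⁻¹ • R) z :=
    (hK₀ z hz).add (((analyticAt_id.sub analyticAt_const).inv (sub_ne_zero.mpr hne)).smul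
      analyticAt_const)
  refine h1.congr ?_
  filter_upwards [hU.mem_nhds hz, isOpen_ne.mem_nhds hne] with w hw hwne
  exact (hK w hw hwne).symm

theorem SimplePoleAt.not_analyticAt (h : SimplePoleAt K z₀ R) : ¬ AnalyticAt ℂ K z₀ := by
  intro hK
  have h1 : ContinuousAt (fun z => (z - z₀) • K z) z₀ := by
    have := hK.continuousAt
    fun_prop
  have h2 := h1.tendsto.mono_left (nhdsWithin_le_nhds (s := {z₀}ᶜ))
  simp only [sub_self, zero_smul] at h2
  exact h.1 (tendsto_nhds_unique h.tendsto_smul h2)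

theorem tendsto_ofReal_nhdsNE (x : ℝ) :
    Filter.Tendsto (fun y : ℝ => (y : ℂ)) (𝓝[≠] x) (𝓝[≠] (x : ℂ)) :=
  tendsto_nhdsWithin_of_tendsto_nhds_of_eventually_within _
    ((Complex.continuous_ofReal.tendsto x).mono_left nhdsWithin_le_nhds)
    (by filter_upwards [self_mem_nhdsWithin] with y hy; simpa using hy)

end Pole

section ReducedProblem

variable {𝓗N : Type*} [NormedAddCommGroup 𝓗N] [InnerProductSpace ℂ 𝓗N] [CompleteSpace 𝓗N]
  {𝓗' : Type*} [NormedAddCommGroup 𝓗'] [InnerProductSpace ℂ 𝓗'] [CompleteSpace 𝓗']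
  (P : SpectralData 𝓗N) (E₀ : ℝ) (T : 𝓗N →L[ℂ] 𝓗')

/-- The part of the spectral subspace at excitation energy `a` that is visible through `T`. -/
def visibleSpace (a : ℝ) : Submodule ℂ 𝓗N :=
  LinearMap.range (P.proj {E₀ + a} ∘L T.adjoint).toLinearMap

/-- The part of the spectral subspace at excitation energies in `S` that is visible through `T`. -/
def visibleSum (S : Finset ℝ) : Submodule ℂ 𝓗N := S.sup (visibleSpace P E₀ T)

/-- The spectral projection onto the excitation energies in `S`. -/
def nearProj (S : Finset ℝ) : 𝓗N →L[ℂ] 𝓗N := ∑ a ∈ S, P.proj {E₀ + a}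

/-- The Schur complement whose kernel describes the poles of `(1 − χ̂_s)⁻¹`, where `J` is the
inverse of the far part of `1 − χ̂_s(x)`. -/
def schurOp (S : Finset ℝ) (x : ℝ) (J : 𝓗' →L[ℂ] 𝓗') : 𝓗N →L[ℂ] 𝓗N :=
  ∑ a ∈ S, (((a ^ 2 - x ^ 2) / (2 * a) : ℝ) : ℂ) • P.proj {E₀ + a} +
    nearProj P E₀ S ∘L T.adjoint ∘L J ∘L T ∘L nearProj P E₀ S

variable {P E₀ T}

theorem proj_apply_of_mem_visibleSpace {a : ℝ} {c : 𝓗N} (hc : c ∈ visibleSpace P E₀ T a) :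
    P.proj {E₀ + a} c = c := by
  obtain ⟨f, rfl⟩ := hc
  exact P.proj_idem (measurableSet_singleton _) _

theorem proj_apply_of_mem_visibleSpace_of_ne {a b : ℝ} (hab : b ≠ a) {c : 𝓗N}
    (hc : c ∈ visibleSpace P E₀ T a) : P.proj {E₀ + b} c = 0 := by
  rw [← proj_apply_of_mem_visibleSpace hc,
    P.proj_proj (measurableSet_singleton _) (measurableSet_singleton _),
    Set.singleton_inter_eq_empty.mpr (by simpa using hab), P.proj_empty]
  rfl

theorem nearProj_apply_of_mem {S : Finset ℝ} {c : 𝓗N} (hc : c ∈ visibleSum P E₀ T S) :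
    nearProj P E₀ S c = c := by
  have hle : visibleSum P E₀ T S ≤
      LinearMap.eqLocus (nearProj P E₀ S).toLinearMap LinearMap.id := by
    refine Finset.sup_le fun a ha c hc => ?_
    simp only [LinearMap.mem_eqLocus, ContinuousLinearMap.coe_coe, LinearMap.id_coe, id_eq,
      nearProj, sum_apply]
    rw [Finset.sum_eq_single_of_mem a ha fun b _ hb =>
      proj_apply_of_mem_visibleSpace_of_ne hb hc, proj_apply_of_mem_visibleSpace hc]
  exact hle hc

theorem visibleSpace_le_visibleSum {S : Finset ℝ} {a : ℝ} (ha : a ∈ S) :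
    visibleSpace P E₀ T a ≤ visibleSum P E₀ T S :=
  Finset.le_sup (f := visibleSpace P E₀ T) ha

theorem eq_zero_of_mem_visibleSpace {a : ℝ} {c : 𝓗N} (hc : c ∈ visibleSpace P E₀ T a)
    (hT : T c = 0) : c = 0 := by
  obtain ⟨f, hf⟩ := hc
  have hf' : P.proj {E₀ + a} (T.adjoint f) = c := hf
  have h1 := P.inner_proj_self (measurableSet_singleton (E₀ + a)) (T.adjoint f)
  rw [ContinuousLinearMap.adjoint_inner_left, hf', hT, inner_zero_right] at h1
  have h2 : ‖c‖ ^ 2 = 0 := by exact_mod_cast h1.symm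
  simpa using h2

theorem visibleSpace_le_range (a : ℝ) :
    visibleSpace P E₀ T a ≤ LinearMap.range (P.proj {E₀ + a}).toLinearMap := by
  rintro _ ⟨f, rfl⟩
  exact ⟨T.adjoint f, rfl⟩

omit [CompleteSpace 𝓗N] [CompleteSpace 𝓗'] in
theorem finiteDimensional_range_comp {A : 𝓗N →L[ℂ] 𝓗N}
    (hA : FiniteDimensional ℂ (LinearMap.range A.toLinearMap)) :
    FiniteDimensional ℂ (LinearMap.range (T ∘L A).toLinearMap) := by
  have : LinearMap.range (T ∘L A).toLinearMap = (LinearMap.range A.toLinearMap).map T.toLinearMap :=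
    LinearMap.range_comp _ _
  rw [this]
  infer_instance

theorem finrank_visibleSpace_le {a : ℝ}
    (hfin : FiniteDimensional ℂ (LinearMap.range (P.proj {E₀ + a}).toLinearMap)) :
    Module.finrank ℂ (visibleSpace P E₀ T a) ≤
      Module.finrank ℂ (LinearMap.range (T ∘L P.proj {E₀ + a}).toLinearMap) := by
  have := finiteDimensional_range_comp (T := T) hfin
  have hmem : ∀ c : visibleSpace P E₀ T a, (T.toLinearMap ∘ₗ (visibleSpace P E₀ T a).subtype) c ∈
      LinearMap.range (T ∘L P.proj {E₀ + a}).toLinearMap := by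
    rintro ⟨c, hc⟩
    refine ⟨c, ?_⟩
    simp [proj_apply_of_mem_visibleSpace hc]
  refine LinearMap.finrank_le_finrank_of_injective
    (f := (T.toLinearMap ∘ₗ (visibleSpace P E₀ T a).subtype).codRestrict _ hmem) ?_
  rw [← LinearMap.ker_eq_bot, LinearMap.ker_codRestrict, LinearMap.ker_eq_bot']
  rintro ⟨c, hc⟩ h
  exact Subtype.ext (eq_zero_of_mem_visibleSpace hc h)

theorem finrank_visibleSum_le {S : Finset ℝ}
    (hfin : ∀ a ∈ S, FiniteDimensional ℂ (LinearMap.range (P.proj {E₀ + a}).toLinearMap)) :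
    FiniteDimensional ℂ (visibleSum P E₀ T S) ∧ Module.finrank ℂ (visibleSum P E₀ T S) ≤
      ∑ a ∈ S, Module.finrank ℂ (LinearMap.range (T ∘L P.proj {E₀ + a}).toLinearMap) := by
  classical
  induction S using Finset.induction_on with
  | empty =>
    rw [visibleSum, Finset.sup_empty]
    exact ⟨inferInstance, by simp⟩
  | insert a S ha ih =>
    obtain ⟨h1, h2⟩ := ih fun b hb => hfin b (Finset.mem_insert_of_mem hb)
    have h3 := hfin a (Finset.mem_insert_self _ _)
    have h4 : FiniteDimensional ℂ (visibleSpace P E₀ T a) :=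
      Submodule.finiteDimensional_of_le (visibleSpace_le_range a)
    have h5 : visibleSum P E₀ T (insert a S) = visibleSpace P E₀ T a ⊔ visibleSum P E₀ T S :=
      Finset.sup_insert
    rw [h5, Finset.sum_insert ha]
    exact ⟨inferInstance, (Submodule.finrank_add_le_finrank_add_finrank _ _).trans
      (add_le_add (finrank_visibleSpace_le h3) h2)⟩

omit [CompleteSpace 𝓗N] in
theorem nearProj_symm (S : Finset ℝ) (c d : 𝓗N) :
    ⟪nearProj P E₀ S c, d⟫_ℂ = ⟪c, nearProj P E₀ S d⟫_ℂ := by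
  simp only [nearProj, sum_apply, sum_inner, inner_sum]
  exact Finset.sum_congr rfl fun a _ => P.proj_symm _ (measurableSet_singleton _) _ _

theorem schurOp_symm (S : Finset ℝ) (x : ℝ) {J : 𝓗' →L[ℂ] 𝓗'}
    (hJ : ∀ f g, ⟪J f, g⟫_ℂ = ⟪f, J g⟫_ℂ) (c d : 𝓗N) :
    ⟪schurOp P E₀ T S x J c, d⟫_ℂ = ⟪c, schurOp P E₀ T S x J d⟫_ℂ := by
  simp only [schurOp, add_apply, sum_apply, smul_apply, ContinuousLinearMap.comp_apply,
    inner_add_left, inner_add_right, sum_inner, inner_sum, inner_smul_left, inner_smul_right,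
    Complex.conj_ofReal]
  congr 1
  · exact Finset.sum_congr rfl fun a _ => by rw [P.proj_symm _ (measurableSet_singleton _)]
  · rw [nearProj_symm, ContinuousLinearMap.adjoint_inner_left, hJ, ← nearProj_symm,
      ContinuousLinearMap.adjoint_inner_right]

theorem re_inner_schurOp {S : Finset ℝ} (x : ℝ) (J : 𝓗' →L[ℂ] 𝓗') {c : 𝓗N}
    (hc : c ∈ visibleSum P E₀ T S) : (⟪c, schurOp P E₀ T S x J c⟫_ℂ).re =
      ∑ a ∈ S, (a ^ 2 - x ^ 2) / (2 * a) * ‖P.proj {E₀ + a} c‖ ^ 2 + (⟪T c, J (T c)⟫_ℂ).re := by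
  simp only [schurOp, add_apply, sum_apply, smul_apply, ContinuousLinearMap.comp_apply,
    inner_add_right, inner_sum, inner_smul_right, Complex.add_re, Complex.re_sum]
  congr 1
  · refine Finset.sum_congr rfl fun a _ => ?_
    rw [P.inner_proj_self (measurableSet_singleton _), Complex.re_ofReal_mul, Complex.ofReal_re]
  · rw [← nearProj_symm, nearProj_apply_of_mem hc, ContinuousLinearMap.adjoint_inner_right]

theorem re_inner_schurOp_lt {S : Finset ℝ} (hS : ∀ a ∈ S, 0 < a) {x y : ℝ} (hxy : |x| < |y|)
    {J K : 𝓗' →L[ℂ] 𝓗'} (hJK : ∀ f, (⟪f, K f⟫_ℂ).re ≤ (⟪f, J f⟫_ℂ).re) {c : 𝓗N}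
    (hc : c ∈ visibleSum P E₀ T S) (hc0 : c ≠ 0) :
    (⟪c, schurOp P E₀ T S y K c⟫_ℂ).re < (⟪c, schurOp P E₀ T S x J c⟫_ℂ).re := by
  have hxy2 := sq_lt_sq.mpr hxy
  rw [re_inner_schurOp y K hc, re_inner_schurOp x J hc]
  refine add_lt_add_of_lt_of_le (Finset.sum_lt_sum (fun a ha => ?_) ?_) (hJK _)
  · have := hS a ha
    gcongr
  · obtain ⟨a, ha, hne⟩ : ∃ a ∈ S, P.proj {E₀ + a} c ≠ 0 := by
      by_contra! h
      refine hc0 ?_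
      rw [← nearProj_apply_of_mem hc, nearProj, sum_apply]
      exact Finset.sum_eq_zero h
    have := hS a ha
    have : 0 < ‖P.proj {E₀ + a} c‖ := norm_pos_iff.mpr hne
    exact ⟨a, ha, by gcongr⟩

end ReducedProblem

section PoleCount

variable {𝓗N : Type*} [NormedAddCommGroup 𝓗N] [InnerProductSpace ℂ 𝓗N] [CompleteSpace 𝓗N]
  {𝓗' : Type*} [NormedAddCommGroup 𝓗'] [InnerProductSpace ℂ 𝓗'] [CompleteSpace 𝓗']
  {P : SpectralData 𝓗N} {E₀ Ω ω : ℝ} {T : 𝓗N →L[ℂ] 𝓗'}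

theorem exists_tendsto_of_tendsto_comp {a : ℝ} [FiniteDimensional ℂ (visibleSpace P E₀ T a)]
    {α : Type*} {l : Filter α} [l.NeBot] {c : α → 𝓗N} (hc : ∀ x, c x ∈ visibleSpace P E₀ T a)
    {w : 𝓗'} (hw : Filter.Tendsto (fun x => T (c x)) l (𝓝 w)) :
    ∃ C ∈ visibleSpace P E₀ T a, Filter.Tendsto c l (𝓝 C) := by
  set A : visibleSpace P E₀ T a →ₗ[ℂ] 𝓗' := T.toLinearMap ∘ₗ (visibleSpace P E₀ T a).subtype
  have hinj : LinearMap.ker A = ⊥ := by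
    rw [LinearMap.ker_eq_bot']
    rintro ⟨c, hc⟩ h
    exact Subtype.ext (eq_zero_of_mem_visibleSpace hc h)
  have hA := LinearMap.isClosedEmbedding_of_injective hinj
  have hw' : Filter.Tendsto (fun x => A ⟨c x, hc x⟩) l (𝓝 w) := hw
  obtain ⟨C, rfl⟩ : w ∈ Set.range A := hA.isClosed_range.mem_of_tendsto hw'
    (Filter.Eventually.of_forall fun x => ⟨_, rfl⟩)
  have h1 := (hA.isInducing.tendsto_nhds_iff (f := fun x => (⟨c x, hc x⟩ : visibleSpace P E₀ T a))
    (l := l) (y := C)).mpr hw'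
  exact ⟨C, C.2, (continuous_subtype_val.tendsto C).comp h1⟩

/-- A limit of approximate solutions of `(Φ x + nearOp x) h = 0` gives a vector in the kernel of
the Schur complement. -/
theorem exists_mem_ker_schurOp {S : Finset ℝ} (hS : ∀ a ∈ S, 0 < a)
    (hfd : ∀ a ∈ S, FiniteDimensional ℂ (visibleSpace P E₀ T a)) {Φ : ℝ → 𝓗' →L[ℂ] 𝓗'} {x₀ : ℝ}
    (hΦ : Filter.Tendsto Φ (𝓝 x₀) (𝓝 (Φ x₀))) {J : 𝓗' →L[ℂ] 𝓗'} (hJ : ∀ f, J (Φ x₀ f) = f)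
    {h : ℝ → 𝓗'} {f g : 𝓗'} (hh : Filter.Tendsto h (𝓝[≠] x₀) (𝓝 f))
    (heq : ∀ᶠ x in 𝓝[≠] x₀,
      Φ x (h x) + nearOp P E₀ T S x (h x) = ((x - x₀ : ℝ) : ℂ) • g) :
    ∃ c ∈ visibleSum P E₀ T S, schurOp P E₀ T S x₀ J c = 0 ∧ f = -J (T c) := by
  classical
  set p : ℝ → ℝ → 𝓗N := fun a x => P.proj {E₀ + a} (T.adjoint (h x)) with hp
  set c : ℝ → ℝ → 𝓗N := fun a x => ((2 * a / (a ^ 2 - x ^ 2) : ℝ) : ℂ) • p a x with hc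
  have hcmem : ∀ a x, c a x ∈ visibleSpace P E₀ T a := fun a x =>
    Submodule.smul_mem _ _ ⟨h x, rfl⟩
  have hplim : ∀ a, Filter.Tendsto (p a) (𝓝[≠] x₀) (𝓝 (P.proj {E₀ + a} (T.adjoint f))) := fun a =>
    (((P.proj {E₀ + a} ∘L T.adjoint).continuous.tendsto f).comp hh)
  have hΦlim : Filter.Tendsto (fun x => Φ x (h x)) (𝓝[≠] x₀) (𝓝 (Φ x₀ f)) :=
    ((isBoundedBilinearMap_apply (𝕜 := ℂ)).continuous.tendsto (Φ x₀, f)).comp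
      ((hΦ.mono_left nhdsWithin_le_nhds).prodMk_nhds hh)
  have hglim : Filter.Tendsto (fun x : ℝ => ((x - x₀ : ℝ) : ℂ) • g) (𝓝[≠] x₀) (𝓝 0) := by
    have h1 : Continuous (fun x : ℝ => ((x - x₀ : ℝ) : ℂ) • g) := by fun_prop
    simpa using (h1.tendsto x₀).mono_left (nhdsWithin_le_nhds (s := {x₀}ᶜ))
  have heq' : ∀ᶠ x in 𝓝[≠] x₀, Φ x (h x) + ∑ a ∈ S, T (c a x) = ((x - x₀ : ℝ) : ℂ) • g := by
    filter_upwards [heq] with x hx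
    rw [← hx, nearOp, sum_apply]
    simp [hc, hp]
  have hreg : ∀ a, a ^ 2 ≠ x₀ ^ 2 → ∃ C, Filter.Tendsto (c a) (𝓝[≠] x₀) (𝓝 C) := by
    intro a ha
    refine ⟨((2 * a / (a ^ 2 - x₀ ^ 2) : ℝ) : ℂ) • P.proj {E₀ + a} (T.adjoint f),
      Filter.Tendsto.smul ?_ (hplim a)⟩
    have h1 : ContinuousAt (fun x : ℝ => 2 * a / (a ^ 2 - x ^ 2)) x₀ :=
      ContinuousAt.div (by fun_prop) (by fun_prop) (sub_ne_zero.mpr ha)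
    exact ((Complex.continuous_ofReal.tendsto _).comp h1.tendsto).mono_left nhdsWithin_le_nhds
  have hTlim : ∀ a ∈ S, ∃ w, Filter.Tendsto (fun x => T (c a x)) (𝓝[≠] x₀) (𝓝 w) := by
    intro a ha
    by_cases hax : a ^ 2 = x₀ ^ 2
    · have hothers : ∀ b ∈ S.erase a, ∃ C, Filter.Tendsto (c b) (𝓝[≠] x₀) (𝓝 C) := by
        intro b hb
        refine hreg b fun hbx => Finset.ne_of_mem_erase hb ?_
        exact (sq_eq_sq₀ (hS b (Finset.mem_of_mem_erase hb)).le (hS a ha).le).mp (hbx.trans hax.symm)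
      choose! C hC using hothers
      refine ⟨0 - Φ x₀ f - ∑ b ∈ S.erase a, T (C b), ?_⟩
      refine ((hglim.sub hΦlim).sub (tendsto_finsetSum _ fun b hb =>
        (T.continuous.tendsto _).comp (hC b hb))).congr' ?_
      filter_upwards [heq'] with x hx
      rw [← hx, ← Finset.add_sum_erase S _ ha]
      simp
    · obtain ⟨C, hC⟩ := hreg a hax
      exact ⟨T C, (T.continuous.tendsto _).comp hC⟩
  have hlim : ∀ a ∈ S, ∃ C ∈ visibleSpace P E₀ T a, Filter.Tendsto (c a) (𝓝[≠] x₀) (𝓝 C) := by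
    intro a ha
    have := hfd a ha
    obtain ⟨w, hw⟩ := hTlim a ha
    exact exists_tendsto_of_tendsto_comp (hcmem a) hw
  choose! C hCmem hC using hlim
  have hPC : ∀ a ∈ S, P.proj {E₀ + a} (∑ b ∈ S, C b) = C a := by
    intro a ha
    rw [map_sum, Finset.sum_eq_single_of_mem a ha fun b hb hba =>
      proj_apply_of_mem_visibleSpace_of_ne hba.symm (hCmem b hb),
      proj_apply_of_mem_visibleSpace (hCmem a ha)]
  have hcmemS : ∑ a ∈ S, C a ∈ visibleSum P E₀ T S :=
    Submodule.sum_mem _ fun a ha => visibleSpace_le_visibleSum ha (hCmem a ha)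
  have hsol : Φ x₀ f + T (∑ a ∈ S, C a) = 0 := by
    rw [map_sum]
    refine tendsto_nhds_unique (hΦlim.add (tendsto_finsetSum _ fun b hb =>
      (T.continuous.tendsto _).comp (hC b hb))) (hglim.congr' ?_)
    filter_upwards [heq'] with x hx using hx.symm
  have hf : f = -J (T (∑ a ∈ S, C a)) := by
    rw [← map_neg, ← eq_neg_iff_add_eq_zero.mpr hsol, hJ]
  have hcoef : ∀ a ∈ S, (((a ^ 2 - x₀ ^ 2) / (2 * a) : ℝ) : ℂ) • C a =
      P.proj {E₀ + a} (T.adjoint f) := by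
    intro a ha
    have h1 : Filter.Tendsto (fun x : ℝ => (((a ^ 2 - x ^ 2) / (2 * a) : ℝ) : ℂ) • c a x) (𝓝[≠] x₀)
        (𝓝 ((((a ^ 2 - x₀ ^ 2) / (2 * a) : ℝ) : ℂ) • C a)) := by
      refine Filter.Tendsto.smul ?_ (hC a ha)
      have h2 : Continuous (fun x : ℝ => (((a ^ 2 - x ^ 2) / (2 * a) : ℝ) : ℂ)) := by fun_prop
      exact (h2.tendsto x₀).mono_left nhdsWithin_le_nhds
    refine tendsto_nhds_unique h1 ((hplim a).congr' ?_)
    filter_upwards [eventually_abs_notMem S x₀] with x hx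
    have ha0 : 2 * a ≠ 0 := (mul_pos two_pos (hS a ha)).ne'
    have hax : a ^ 2 - x ^ 2 ≠ 0 := by
      intro h0
      refine hx ?_
      rwa [← (sq_eq_sq₀ (hS a ha).le (abs_nonneg x)).mp (by rw [sq_abs]; linarith)]
    have h3 : (a ^ 2 - x ^ 2) / (2 * a) * (2 * a / (a ^ 2 - x ^ 2)) = 1 := by
      have := (hS a ha).ne'
      field_simp
    rw [hc, smul_smul, ← Complex.ofReal_mul, h3, Complex.ofReal_one, one_smul]
  refine ⟨∑ a ∈ S, C a, hcmemS, ?_, hf⟩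
  have hJT : J (T (∑ a ∈ S, C a)) = -f := by rw [hf, neg_neg]
  simp only [schurOp, add_apply, sum_apply, smul_apply, ContinuousLinearMap.comp_apply]
  rw [nearProj_apply_of_mem hcmemS, hJT, map_neg, map_neg, nearProj, sum_apply, ← sub_eq_add_neg,
    sub_eq_zero]
  exact Finset.sum_congr rfl fun a ha => by rw [hPC a ha, hcoef a ha]

theorem finrank_residue_le {Ψ₀ : 𝓗N} (hgs : IsGroundState P E₀ Ψ₀)
    (hω : E₀ + ω ≤ sInf P.essSpec) (hωΩ : ω ≤ Ω) {S : Finset ℝ}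
    (hS : ∀ a, a ∈ S ↔ 0 < a ∧ a < ω ∧ T ∘L P.proj {E₀ + a} ≠ 0) {χs : ℂ → 𝓗' →L[ℂ] 𝓗'}
    (hχs : IsSymmetrizedDDRF P E₀ Ω T χs) {G : ℂ → 𝓗' →L[ℂ] 𝓗'}
    (hGinv : ∀ z ∈ DOmega Ω \ chisPoles P E₀ Ω T, AnalyticAt ℂ G z → (1 - χs z) ∘L G z = 1)
    [FiniteDimensional ℂ (visibleSum P E₀ T S)] {Φ : ℝ → 𝓗' →L[ℂ] 𝓗'}
    (hΦ : ∀ x, |x| < ω → ∀ f, ⟪f, Φ x f⟫_ℂ = (farForm P E₀ ω T x f : ℂ)) {x₀ : ℝ}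
    (hx₀ : |x₀| < ω) {J : 𝓗' →L[ℂ] 𝓗'} (hJ : ∀ f, J (Φ x₀ f) = f) {R : 𝓗' →L[ℂ] 𝓗'}
    (hR : SimplePoleAt G (x₀ : ℂ) R) :
    Module.finrank ℂ (LinearMap.range R.toLinearMap) ≤ Module.finrank ℂ
      (visibleSum P E₀ T S ⊓ LinearMap.ker (schurOp P E₀ T S x₀ J).toLinearMap :) := by
  set N := visibleSum P E₀ T S ⊓ LinearMap.ker (schurOp P E₀ T S x₀ J).toLinearMap
  have hN : FiniteDimensional ℂ N := Submodule.finiteDimensional_of_le inf_le_left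
  refine (Submodule.finrank_mono ?_).trans (Submodule.finrank_map_le (-(J ∘L T)).toLinearMap N)
  rintro _ ⟨g, rfl⟩
  have hlim : Filter.Tendsto (fun x : ℝ => (((x : ℂ) - x₀) • G x) g) (𝓝[≠] x₀) (𝓝 (R g)) :=
    ((ContinuousLinearMap.apply ℂ 𝓗' g).continuous.tendsto R).comp
      (hR.tendsto_smul.comp (tendsto_ofReal_nhdsNE x₀))
  have heq : ∀ᶠ x : ℝ in 𝓝[≠] x₀, Φ x ((((x : ℂ) - x₀) • G x) g) +
      nearOp P E₀ T S x ((((x : ℂ) - x₀) • G x) g) = ((x - x₀ : ℝ) : ℂ) • g := by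
    have hlt : ∀ᶠ x : ℝ in 𝓝[≠] x₀, |x| < ω :=
      ((continuous_abs.tendsto x₀).eventually_lt_const hx₀).filter_mono nhdsWithin_le_nhds
    filter_upwards [hlt, eventually_abs_notMem S x₀,
      (tendsto_ofReal_nhdsNE x₀).eventually hR.eventually_analyticAt] with x hx hxS hxG
    have hreg := mem_regular hωΩ hS hx hxS
    have h1 : Φ x = 1 - χs x - nearOp P E₀ T S x := eq_of_inner_self_eq fun f => by
      rw [hΦ x hx, inner_one_sub_sub_nearOp hgs hω hS hχs hx hreg]
    have h2 : (1 - χs x) (G x g) = g := DFunLike.congr_fun (hGinv x hreg hxG) g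
    rw [h1, sub_apply, sub_add_cancel, smul_apply, map_smul, h2]
    push_cast
    rfl
  obtain ⟨c, hc, hc0, hRc⟩ := exists_mem_ker_schurOp (fun a ha => ((hS a).mp ha).1)
    (fun a ha => Submodule.finiteDimensional_of_le (visibleSpace_le_visibleSum ha))
    (tendsto_farOp hΦ hx₀) hJ hlim heq
  exact ⟨c, ⟨hc, hc0⟩, hRc.symm⟩

theorem poleRank_eq_finrank {E F : Type*} [NormedAddCommGroup E] [NormedSpace ℂ E]
    [NormedAddCommGroup F] [NormedSpace ℂ F] {K : ℂ → E →L[ℂ] F} {z₀ : ℂ} (h : IsPoleAt K z₀) :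
    ∃ R, SimplePoleAt K z₀ R ∧ poleRank K z₀ = Module.finrank ℂ (LinearMap.range R.toLinearMap) :=
  ⟨_, Exists.choose_spec h, dif_pos h⟩

/-- Poles of `(1 − χ̂_s)⁻¹` in `(−ω, ω)` with distinct absolute values have total rank at most the
total rank of the poles of `χ̂_s` in `(0, ω)`. -/
theorem sum_poleRank_le {Ψ₀ : 𝓗N} (hgs : IsGroundState P E₀ Ψ₀)
    (hω : E₀ + ω ≤ sInf P.essSpec) (hωΩ : ω ≤ Ω) {S : Finset ℝ}
    (hS : ∀ a, a ∈ S ↔ 0 < a ∧ a < ω ∧ T ∘L P.proj {E₀ + a} ≠ 0)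
    (hfin : ∀ a ∈ S, FiniteDimensional ℂ (LinearMap.range (P.proj {E₀ + a}).toLinearMap))
    {χs : ℂ → 𝓗' →L[ℂ] 𝓗'} (hχs : IsSymmetrizedDDRF P E₀ Ω T χs) {G : ℂ → 𝓗' →L[ℂ] 𝓗'}
    (hGinv : ∀ z ∈ DOmega Ω \ chisPoles P E₀ Ω T, AnalyticAt ℂ G z → (1 - χs z) ∘L G z = 1)
    (F : Finset ℝ) (hF : ∀ x ∈ F, |x| < ω ∧ IsPoleAt G (x : ℂ))
    (hinj : Set.InjOn (fun x : ℝ => |x|) F) :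
    ∑ x ∈ F, poleRank G (x : ℂ) ≤
      ∑ a ∈ S, Module.finrank ℂ (LinearMap.range (T ∘L P.proj {E₀ + a}).toLinearMap) := by
  obtain ⟨hfd, hdim⟩ := finrank_visibleSum_le (T := T) hfin
  have hex : ∀ x : ℝ, ∃ A : 𝓗' →L[ℂ] 𝓗', |x| < ω →
      ∀ f, ⟪f, A f⟫_ℂ = (farForm P E₀ ω T x f : ℂ) := fun x => by
    by_cases hx : |x| < ω
    · obtain ⟨A, hA⟩ := exists_farOp hgs hω hωΩ hS hχs hx
      exact ⟨A, fun _ => hA⟩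
    · exact ⟨0, fun h => absurd h hx⟩
  choose Φ hΦ using hex
  have hexJ : ∀ x : ℝ, ∃ J : 𝓗' →L[ℂ] 𝓗', |x| < ω →
      (∀ f, J (Φ x f) = f) ∧ ∀ f, Φ x (J f) = f := fun x => by
    by_cases hx : |x| < ω
    · obtain ⟨J, hJ⟩ := exists_inverse_of_one_le (hΦ x hx) (sq_norm_le_farForm P T hx)
      exact ⟨J, fun _ => hJ⟩
    · exact ⟨0, fun h => absurd h hx⟩
  choose J hJ using hexJ
  refine le_trans (Finset.sum_le_sum fun x hx => ?_) ((sum_finrank_ker_le_of_strictAnti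
    (visibleSum P E₀ T S) (fun x => schurOp P E₀ T S x (J x))
    (fun x => visibleSum P E₀ T S ⊓ LinearMap.ker (schurOp P E₀ T S x (J x)).toLinearMap)
    (fun x => |x|) {x | |x| < ω} (fun x hx c d => ?_) (fun x hx y hy hxy c hc hc0 => ?_)
    (fun x => inf_le_left) (fun x _ c hc => hc.2) F (fun x hx => (hF x hx).1) hinj).trans hdim)
  · obtain ⟨R, hR, hrank⟩ := poleRank_eq_finrank (hF x hx).2
    rw [hrank]
    exact finrank_residue_le hgs hω hωΩ hS hχs hGinv hΦ (hF x hx).1 (hJ x (hF x hx).1).1 hR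
  · exact schurOp_symm S x (inverse_isSymmetric (hΦ x hx) (hJ x hx).2) c d
  · exact re_inner_schurOp_lt (fun a ha => ((hS a).mp ha).1) hxy
      (inner_inverse_antitone (hΦ x hx) (hΦ y hy) (hJ x hx).2 (hJ y hy).2
        (fun f => (sq_nonneg _).trans (sq_norm_le_farForm P T hx f))
        (fun f => farForm_mono P T hxy.le hy f)) hc hc0

end PoleCount

/-- Proposition 4.2, forward shift of the poles of `(1−χ̂_s)⁻¹`: for every
`0 < ω < Ω`,
`Σ_{ω̃ ∈ P((1−χ̂_s)⁻¹), |ω̃|<ω} rank_{ω̃}((1−χ̂_s)⁻¹) ≤ Σ_{ω̃ ∈ P(χ̂_s), |ω̃|<ω} rank_{ω̃}(χ̂_s)`,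
the rank of a pole `ω̃` of `χ̂_s` being `rank(T P^H_{E₀+|ω̃|})`. -/
theorem symmetrized_resolvent_forward_shift
    {𝓗N 𝓗' : Type*} [NormedAddCommGroup 𝓗N] [InnerProductSpace ℂ 𝓗N] [CompleteSpace 𝓗N]
    [NormedAddCommGroup 𝓗'] [InnerProductSpace ℂ 𝓗'] [CompleteSpace 𝓗']
    (P : SpectralData 𝓗N) (E₀ : ℝ) (Ψ₀ : 𝓗N) (hgs : IsGroundState P E₀ Ψ₀)
    (Ω : ℝ) (hness : P.essSpec.Nonempty) (hΩ : Ω = sInf P.essSpec - E₀) (hΩpos : 0 < Ω)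
    (T : 𝓗N →L[ℂ] 𝓗')
    (hker : LinearMap.ker ((ContinuousLinearMap.id ℂ 𝓗N - P.proj {E₀}) ∘L T.adjoint).toLinearMap = ⊥)
    (hfin : ∀ ω : ℝ, |ω| < Ω → FiniteDimensional ℂ ↥(LinearMap.range (P.proj {E₀ + |ω|}).toLinearMap))
    (χs : ℂ → (𝓗' →L[ℂ] 𝓗')) (hχs : IsSymmetrizedDDRF P E₀ Ω T χs)
    -- `G` is the meromorphic family `(1 − χ̂_s)⁻¹` on `D_Ω`, with simple real poles
    (G : ℂ → (𝓗' →L[ℂ] 𝓗'))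
    (hGinv : ∀ z ∈ DOmega Ω \ chisPoles P E₀ Ω T, AnalyticAt ℂ G z →
      G z ∘L (1 - χs z) = 1 ∧ (1 - χs z) ∘L G z = 1)
    (hGm : MeromOn G (DOmega Ω))
    (hGpoles : ∀ z₀ ∈ DOmega Ω, ¬ AnalyticAt ℂ G z₀ → IsPoleAt G z₀ ∧ z₀.im = 0) :
    ∀ ω : ℝ, 0 < ω → ω < Ω →
      ∑' x : {z : ℂ | IsPoleAt G z ∧ ‖z‖ < ω},
        (poleRank G (x : ℂ) : ℝ≥0∞) ≤
      ∑' x : {z : ℂ | z ∈ chisPoles P E₀ Ω T ∧ ‖z‖ < ω},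
        ((Module.finrank ℂ
          ↥(LinearMap.range (T ∘L P.proj {E₀ + |(x : ℂ).re|}).toLinearMap)) : ℝ≥0∞) := by
  intro ω hω0 hωΩ
  have hω : E₀ + ω ≤ sInf P.essSpec := by linarith
  set A : Set ℂ := {z : ℂ | z ∈ chisPoles P E₀ Ω T ∧ ‖z‖ < ω} with hA
  set ρ : ℂ → ℕ := fun z =>
    Module.finrank ℂ (LinearMap.range (T ∘L P.proj {E₀ + |z.re|}).toLinearMap) with hρ
  have hAreal : ∀ z ∈ A, z = (z.re : ℂ) ∧ z.re ≠ 0 ∧ |z.re| < ω ∧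
      T ∘L P.proj {E₀ + |z.re|} ≠ 0 := by
    rintro _ ⟨⟨x, rfl, hx0, -, hx⟩, hxω⟩
    exact ⟨rfl, hx0, by simpa using hxω, hx⟩
  have hAmem : ∀ x : ℝ, x ≠ 0 → |x| < ω → T ∘L P.proj {E₀ + |x|} ≠ 0 → (x : ℂ) ∈ A :=
    fun x hx0 hx hT => ⟨⟨x, rfl, hx0, hx.trans hωΩ, hT⟩, by simpa using hx⟩
  rcases eq_or_ne (∑' z : A, (ρ z : ℝ≥0∞)) ⊤ with htop | htop
  · exact le_top.trans_eq htop.symm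
  have hAfin : A.Finite := by
    have h1 := ENNReal.finite_const_le_of_tsum_ne_top htop one_ne_zero
    have h2 : {z : A | 1 ≤ (ρ z : ℝ≥0∞)} = Set.univ := by
      refine Set.eq_univ_of_forall fun z => ?_
      obtain ⟨-, -, hz, hT⟩ := hAreal z z.2
      have := finiteDimensional_range_comp (T := T) (hfin _ (hz.trans hωΩ))
      have h3 : 0 < ρ z := by
        rw [hρ, Module.finrank_pos_iff, Submodule.nontrivial_iff_ne_bot, ne_eq,
          LinearMap.range_eq_bot]
        exact fun h => hT (ContinuousLinearMap.coe_injective h)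
      exact_mod_cast Nat.succ_le_of_lt h3
    rw [h2] at h1
    exact Set.finite_coe_iff.mp (Set.finite_univ_iff.mp h1)
  classical
  obtain ⟨S, hS⟩ : ∃ S : Finset ℝ, ∀ a, a ∈ S ↔ 0 < a ∧ a < ω ∧ T ∘L P.proj {E₀ + a} ≠ 0 := by
    refine ⟨hAfin.toFinset.image fun z => |z.re|, fun a => ?_⟩
    simp only [Finset.mem_image, Set.Finite.mem_toFinset]
    constructor
    · rintro ⟨z, hz, rfl⟩
      obtain ⟨-, h0, hlt, hT⟩ := hAreal z hz
      exact ⟨abs_pos.mpr h0, hlt, hT⟩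
    · rintro ⟨h0, hlt, hT⟩
      rw [← abs_of_pos h0] at hlt hT
      exact ⟨a, hAmem a h0.ne' hlt hT, by simp [abs_of_pos h0]⟩
  have hfinS : ∀ a ∈ S,
      FiniteDimensional ℂ (LinearMap.range (P.proj {E₀ + a}).toLinearMap) := by
    intro a ha
    obtain ⟨h0, hlt, -⟩ := (hS a).mp ha
    rw [← abs_of_pos h0] at hlt
    have := hfin a (hlt.trans hωΩ)
    rwa [abs_of_pos h0] at this
  set D : ℕ := ∑ a ∈ S, Module.finrank ℂ (LinearMap.range (T ∘L P.proj {E₀ + a}).toLinearMap)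
    with hD
  have hlower : (D : ℝ≥0∞) + D ≤ ∑' z : A, (ρ z : ℝ≥0∞) := by
    set F : Finset ℂ := S.image (fun a : ℝ => (a : ℂ)) ∪ S.image (fun a : ℝ => ((-a : ℝ) : ℂ))
    have hFA : (F : Set ℂ) ⊆ A := by
      intro z hz
      simp only [F, Finset.coe_union, Finset.coe_image, Set.mem_union, Set.mem_image,
        Finset.mem_coe] at hz
      rcases hz with ⟨a, ha, rfl⟩ | ⟨a, ha, rfl⟩ <;> obtain ⟨h0, hlt, hT⟩ := (hS a).mp ha <;>
        rw [← abs_of_pos h0] at hlt hT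
      · exact hAmem a h0.ne' hlt hT
      · exact hAmem (-a) (neg_ne_zero.mpr h0.ne') (by rwa [abs_neg]) (by rwa [abs_neg])
    have hdisj : Disjoint (S.image (fun a : ℝ => (a : ℂ)))
        (S.image (fun a : ℝ => ((-a : ℝ) : ℂ))) := by
      rw [Finset.disjoint_left]
      intro z hz hz'
      obtain ⟨a, ha, rfl⟩ := Finset.mem_image.mp hz
      obtain ⟨b, hb, hab⟩ := Finset.mem_image.mp hz'
      have h1 : -b = a := by exact_mod_cast hab
      linarith [((hS a).mp ha).1, ((hS b).mp hb).1]
    have hsum : ∑ z ∈ F, ρ z = D + D := by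
      rw [Finset.sum_union hdisj, Finset.sum_image (by intro a _ b _ h; simpa using h),
        Finset.sum_image (by intro a _ b _ h; simpa using h)]
      congr 1 <;> refine Finset.sum_congr rfl fun a ha => ?_
      · simp only [hρ]
        rw [Complex.ofReal_re, abs_of_pos ((hS a).mp ha).1]
      · simp only [hρ]
        rw [Complex.ofReal_re, abs_neg, abs_of_pos ((hS a).mp ha).1]
    calc (D : ℝ≥0∞) + D = ∑ z ∈ F, (ρ z : ℝ≥0∞) := by exact_mod_cast hsum.symm
      _ = ∑' z : (F : Set ℂ), (ρ z : ℝ≥0∞) :=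
        (Finset.tsum_subtype F fun z => (ρ z : ℝ≥0∞)).symm
      _ ≤ _ := ENNReal.tsum_mono_subtype (fun z => (ρ z : ℝ≥0∞)) hFA
  have hpole : ∀ z, IsPoleAt G z → ‖z‖ < ω → z = (z.re : ℂ) ∧ |z.re| < ω := by
    rintro z ⟨R, hR⟩ hz
    have hre := (Complex.abs_re_le_norm z).trans_lt hz
    refine ⟨Complex.ext rfl ?_, hre⟩
    simpa using (hGpoles z (Or.inr (hre.trans hωΩ)) hR.not_analyticAt).2
  have hcount := sum_poleRank_le hgs hω hωΩ.le hS hfinS hχs (fun z hz hG => (hGinv z hz hG).2)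
  refine le_trans ?_ hlower
  rw [ENNReal.tsum_eq_iSup_sum]
  refine iSup_le fun s => ?_
  set F : Finset ℝ := s.image fun z : {z : ℂ | IsPoleAt G z ∧ ‖z‖ < ω} => (z : ℂ).re
  have hF : ∀ x ∈ F, |x| < ω ∧ IsPoleAt G (x : ℂ) := by
    intro x hx
    obtain ⟨z, -, rfl⟩ := Finset.mem_image.mp hx
    obtain ⟨hz, hlt⟩ := hpole z z.2.1 z.2.2
    exact ⟨hlt, hz ▸ z.2.1⟩
  have hsum : ∑ z ∈ s, poleRank G (z : ℂ) = ∑ x ∈ F, poleRank G (x : ℂ) := by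
    rw [Finset.sum_image]
    · exact Finset.sum_congr rfl fun z _ => by rw [← (hpole z z.2.1 z.2.2).1]
    · intro z _ w _ h
      refine Subtype.ext ?_
      rw [(hpole z z.2.1 z.2.2).1, (hpole w w.2.1 w.2.2).1]
      exact congrArg _ h
  have hbound : ∑ z ∈ s, poleRank G (z : ℂ) ≤ D + D := by
    rw [hsum, ← Finset.sum_filter_add_sum_filter_not F (fun x => 0 ≤ x)]
    refine add_le_add (hcount _ (fun x hx => hF x (Finset.mem_filter.mp hx).1) ?_)
      (hcount _ (fun x hx => hF x (Finset.mem_filter.mp hx).1) ?_)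
    · intro x hx y hy h
      have hx0 := (Finset.mem_filter.mp hx).2
      have hy0 := (Finset.mem_filter.mp hy).2
      simpa [abs_of_nonneg hx0, abs_of_nonneg hy0] using h
    · intro x hx y hy h
      have hx0 := not_le.mp (Finset.mem_filter.mp hx).2
      have hy0 := not_le.mp (Finset.mem_filter.mp hy).2
      simpa [abs_of_neg hx0, abs_of_neg hy0] using h
  exact_mod_cast hbound

end
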